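/- arXiv:1910.09192 — 2 statements merged into one kernel-verified Lean document; each statement's English description precedes it below -/
import Mathlib

section
/- For each fixed z with z ≠ 0, as α → ±∞ the GABSN(α,β,λ) density converges pointwise to 2z²φ(z)Φ(λz), the generalized bimodal normal GBN(2) density (for λ fixed and β fixed). -/
open Real MeasureTheory Filter

/-- standard normal pdf -/
noncomputable def phi (z : ℝ) : ℝ := (Real.sqrt (2 * Real.pi))⁻¹ * Real.exp (-z ^ 2 / 2)

/-- standard normal cdf -/
noncomputable def Phi (z : ℝ) : ℝ := ∫ t in Set.Iic z, phi t

noncomputable def bconst : ℝ := Real.sqrt (2 / Real.pi)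

noncomputable def del (l : ℝ) : ℝ := l / Real.sqrt (1 + l ^ 2)

/-- GABSN normalizing constant -/
noncomputable def C (a β l : ℝ) : ℝ :=
  1 + 3 * a * β - a * bconst * del l - β * bconst * del l * (3 + 2 * l ^ 2) / (1 + l ^ 2)
    + a ^ 2 / 2 + 15 * β ^ 2 / 2

/-- GABSN density -/
noncomputable def f (a β l z : ℝ) : ℝ :=
  (((1 - a * z - β * z ^ 3) ^ 2 + 1) * phi z * Phi (l * z)) / C a β l

/-- Both limits follow from the substitution `u = 1 / a`, `u → 0`. -/
theorem f_tendsto_aux (β l z : ℝ) (F : Filter ℝ) (h0 : ∀ᶠ a in F, a ≠ 0)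
    (hF : Tendsto (fun a : ℝ => a⁻¹) F (nhds 0)) :
    Tendsto (fun a : ℝ => f a β l z) F (nhds (2 * z ^ 2 * phi z * Phi (l * z))) := by
  let K : ℝ := 1 - β * bconst * del l * (3 + 2 * l ^ 2) / (1 + l ^ 2) + 15 * β ^ 2 / 2
  let g : ℝ → ℝ := fun u =>
    (((u - z - β * z ^ 3 * u) ^ 2 + u ^ 2) * phi z * Phi (l * z)) /
      (K * u ^ 2 + (3 * β - bconst * del l) * u + 1 / 2)
  have hg : ContinuousAt g 0 := by
    apply ContinuousAt.div
    · fun_prop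
    · fun_prop
    · norm_num
  have hg0 : g 0 = 2 * z ^ 2 * phi z * Phi (l * z) := by
    simp only [g]
    norm_num
    ring
  have h := hg.tendsto.comp hF
  rw [hg0] at h
  refine h.congr' ?_
  filter_upwards [h0] with a ha
  have hN : (a⁻¹ - z - β * z ^ 3 * a⁻¹) ^ 2 + a⁻¹ ^ 2
      = ((1 - a * z - β * z ^ 3) ^ 2 + 1) * (a⁻¹) ^ 2 := by
    field_simp
  have hD : K * a⁻¹ ^ 2 + (3 * β - bconst * del l) * a⁻¹ + 1 / 2
      = C a β l * (a⁻¹) ^ 2 := by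
    have e : C a β l = K + (3 * β - bconst * del l) * a + a ^ 2 / 2 := by
      simp only [C, K]
      ring
    rw [e]
    field_simp
  have hu : (a⁻¹) ^ 2 ≠ 0 := pow_ne_zero _ (inv_ne_zero ha)
  simp only [Function.comp, g, f]
  rw [hN, hD, ← mul_div_mul_right _ (C a β l) hu]
  congr 1
  ring

theorem stmt_5 (β l : ℝ) (z : ℝ) (hz : z ≠ 0) :
    Tendsto (fun a : ℝ => f a β l z) atTop (nhds (2 * z ^ 2 * phi z * Phi (l * z))) ∧
    Tendsto (fun a : ℝ => f a β l z) atBot (nhds (2 * z ^ 2 * phi z * Phi (l * z))) := by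
  exact ⟨f_tendsto_aux β l z atTop (eventually_ne_atTop 0) tendsto_inv_atTop_zero,
    f_tendsto_aux β l z atBot (eventually_ne_atBot 0) tendsto_inv_atBot_zero⟩
end

section
/- The mean of Z ~ GABSN(α,β,λ) equals [−α − 3β + bδ + bδα²(3+2λ²)/(2(1+λ²)) + bδαβ(15+20λ²+8λ⁴)/(1+λ²)² + 3bδβ²(35+70λ²+56λ⁴+16λ⁶)/(2(1+λ²)³)] / C(α,β,λ). -/
open Real MeasureTheory Filter

lemma gauss_int (n : ℕ) {c : ℝ} (hc : 0 < c) :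
    Integrable (fun z : ℝ => z ^ n * Real.exp (-c * z ^ 2)) := by
  have := integrable_rpow_mul_exp_neg_mul_sq hc (s := n) (by have : (0:ℝ) ≤ n := n.cast_nonneg
                                                             linarith)
  simpa [Real.rpow_natCast] using this

lemma phi_cont : Continuous phi := by unfold phi; fun_prop

lemma phi_nonneg (z : ℝ) : 0 ≤ phi z := by unfold phi; positivity

lemma phi_deriv (z : ℝ) : HasDerivAt phi (-z * phi z) z := by
  have h : HasDerivAt (fun z : ℝ => -z ^ 2 / 2) (-z) z := by
    have := ((hasDerivAt_pow 2 z).neg).div_const 2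
    refine this.congr_deriv ?_
    norm_num; ring
  have := (h.exp).const_mul (Real.sqrt (2 * Real.pi))⁻¹
  refine this.congr_deriv ?_
  unfold phi
  ring

lemma pow_phi_int (n : ℕ) : Integrable (fun z : ℝ => z ^ n * phi z) := by
  have := (gauss_int n (c := 1/2) (by norm_num)).const_mul (Real.sqrt (2 * Real.pi))⁻¹
  convert this using 2 with z
  unfold phi
  rw [show -z ^ 2 / 2 = -(1/2) * z^2 by ring]; ring

lemma phi_int : Integrable phi := by simpa using pow_phi_int 0

lemma phi_total : ∫ z, phi z = 1 := by
  unfold phi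
  rw [integral_const_mul]
  have := integral_gaussian (1/2)
  have e : (fun z : ℝ => Real.exp (-z ^ 2 / 2)) = fun z => Real.exp (-(1/2) * z ^ 2) := by
    ext z; congr 1; ring
  rw [e, this, show Real.pi / (1/2) = 2 * Real.pi by ring]
  exact inv_mul_cancel₀ (by positivity)

lemma Phi_nonneg (z : ℝ) : 0 ≤ Phi z := integral_nonneg fun t => phi_nonneg t

lemma Phi_le (z : ℝ) : Phi z ≤ 1 := by
  rw [← phi_total]
  exact setIntegral_le_integral phi_int (Eventually.of_forall phi_nonneg)

lemma Phi_deriv (z : ℝ) : HasDerivAt Phi (phi z) z := by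
  have e : Phi = fun z => (∫ t in (0:ℝ)..z, phi t) + Phi 0 := by
    ext z
    have := intervalIntegral.integral_Iic_sub_Iic (f := phi) (μ := volume) (a := 0) (b := z)
      phi_int.integrableOn phi_int.integrableOn
    unfold Phi
    linarith
  rw [e]
  exact (intervalIntegral.integral_hasDerivAt_right (phi_cont.intervalIntegrable _ _)
    phi_cont.stronglyMeasurable.stronglyMeasurableAtFilter phi_cont.continuousAt).add_const _

lemma Phi_cont : Continuous Phi :=
  continuous_iff_continuousAt.2 fun z => (Phi_deriv z).continuousAt

lemma phi_neg (z : ℝ) : phi (-z) = phi z := by simp [phi]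

lemma Phi_neg (z : ℝ) : Phi z + Phi (-z) = 1 := by
  have h1 : Phi (-z) = ∫ t in Set.Ioi z, phi t := by
    unfold Phi
    have := integral_comp_neg_Iic (-z) phi
    simp only [phi_neg, neg_neg] at this
    exact this
  rw [h1, ← phi_total, Phi, ← integral_add_compl (measurableSet_Iic (a := z)) phi_int, Set.compl_Iic]

lemma M_int (l : ℝ) (n : ℕ) : Integrable (fun z : ℝ => z ^ n * phi z * Phi (l * z)) := by
  refine (pow_phi_int n).mul_bdd (c := 1) ?_ ?_
  · exact (Phi_cont.comp (continuous_const.mul continuous_id)).aestronglyMeasurable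
  · refine Eventually.of_forall fun z => ?_
    rw [Real.norm_eq_abs, abs_of_nonneg (Phi_nonneg _)]
    exact Phi_le _

/-- product of the two normal densities -/
lemma phi_mul (l z : ℝ) : phi z * phi (l * z)
    = (2 * Real.pi)⁻¹ * Real.exp (-((1 + l ^ 2) / 2) * z ^ 2) := by
  unfold phi
  have h : (Real.sqrt (2 * Real.pi))⁻¹ * (Real.sqrt (2 * Real.pi))⁻¹ = (2 * Real.pi)⁻¹ := by
    rw [← mul_inv, Real.mul_self_sqrt (by positivity)]
  rw [← h, show -((1 + l ^ 2) / 2) * z ^ 2 = -z ^ 2 / 2 + -(l * z) ^ 2 / 2 by ring, Real.exp_add]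
  ring

lemma G_int (l : ℝ) (n : ℕ) : Integrable (fun z : ℝ => z ^ n * (phi z * phi (l * z))) := by
  have := (gauss_int n (c := (1 + l ^ 2) / 2) (by positivity)).const_mul (2 * Real.pi)⁻¹
  convert this using 2 with z
  rw [phi_mul]; ring

noncomputable def MM (l : ℝ) (n : ℕ) : ℝ := ∫ z : ℝ, z ^ n * phi z * Phi (l * z)
noncomputable def GG (l : ℝ) (n : ℕ) : ℝ := ∫ z : ℝ, z ^ n * (phi z * phi (l * z))

lemma lin_deriv (l z : ℝ) : HasDerivAt (fun z : ℝ => l * z) l z := by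
  simpa using (hasDerivAt_id z).const_mul l

lemma MM_one (l : ℝ) : MM l 1 = l * GG l 0 := by
  have h := integral_eq_zero_of_hasDerivAt_of_integrable
    (f := fun z => phi z * Phi (l * z))
    (f' := fun z => l * (z ^ 0 * (phi z * phi (l * z))) - z ^ 1 * phi z * Phi (l * z))
    (fun z => by
      have := (phi_deriv z).mul ((Phi_deriv (l * z)).comp z (lin_deriv l z))
      refine this.congr_deriv ?_
      simp only [Function.comp]; ring)
    (((G_int l 0).const_mul l).sub (M_int l 1)) (by simpa using M_int l 0)
  rw [integral_sub ((G_int l 0).const_mul l) (M_int l 1), integral_const_mul] at h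
  unfold MM GG; linarith

lemma MM_rec (l : ℝ) (n : ℕ) : MM l (n + 2) = (n + 1) * MM l n + l * GG l (n + 1) := by
  have i1 := (M_int l n).const_mul ((n : ℝ) + 1)
  have i2 := (G_int l (n + 1)).const_mul l
  have h := integral_eq_zero_of_hasDerivAt_of_integrable
    (f := fun z => z ^ (n + 1) * phi z * Phi (l * z))
    (f' := fun z => ((n : ℝ) + 1) * (z ^ n * phi z * Phi (l * z))
      + l * (z ^ (n + 1) * (phi z * phi (l * z))) - z ^ (n + 2) * phi z * Phi (l * z))
    (fun z => by
      have := ((hasDerivAt_pow (n + 1) z).mul (phi_deriv z)).mul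
        ((Phi_deriv (l * z)).comp z (lin_deriv l z))
      refine this.congr_deriv ?_
      simp only [Function.comp, Pi.mul_apply]; push_cast; (try simp only [Nat.add_sub_cancel]); ring)
    ((i1.fun_add i2).sub (M_int l (n + 2))) (M_int l (n + 1))
  rw [integral_sub (i1.fun_add i2) (M_int l (n + 2)), integral_add i1 i2, integral_const_mul,
    integral_const_mul] at h
  unfold MM GG; linarith

lemma GG_rec (l : ℝ) (n : ℕ) : (1 + l ^ 2) * GG l (n + 2) = (n + 1) * GG l n := by
  have i1 := (G_int l n).const_mul ((n : ℝ) + 1)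
  have i2 := (G_int l (n + 2)).const_mul (1 + l ^ 2)
  have h := integral_eq_zero_of_hasDerivAt_of_integrable
    (f := fun z => z ^ (n + 1) * (phi z * phi (l * z)))
    (f' := fun z => ((n : ℝ) + 1) * (z ^ n * (phi z * phi (l * z)))
      - (1 + l ^ 2) * (z ^ (n + 2) * (phi z * phi (l * z))))
    (fun z => by
      have := (hasDerivAt_pow (n + 1) z).mul ((phi_deriv z).mul
        ((phi_deriv (l * z)).comp z (lin_deriv l z)))
      refine this.congr_deriv ?_
      simp only [Function.comp, Pi.mul_apply]; push_cast; (try simp only [Nat.add_sub_cancel]); ring)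
    (i1.sub i2) (G_int l (n + 1))
  rw [integral_sub i1 i2, integral_const_mul, integral_const_mul] at h
  unfold GG; linarith

lemma GG_odd (l : ℝ) (n : ℕ) (hn : Odd n) : GG l n = 0 := by
  have h := integral_neg_eq_self (fun z : ℝ => z ^ n * (phi z * phi (l * z))) volume
  simp only [mul_neg, phi_neg, hn.neg_pow, neg_mul, integral_neg] at h
  unfold GG; linarith

lemma MM_zero (l : ℝ) : MM l 0 = 1 / 2 := by
  have h := integral_neg_eq_self (fun z : ℝ => z ^ 0 * phi z * Phi (l * z)) volume
  have i := (M_int l 0).comp_neg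
  have h2 : ∫ z : ℝ, (z ^ 0 * phi z * Phi (l * z) + (-z) ^ 0 * phi (-z) * Phi (l * -z)) = 1 := by
    rw [← phi_total]
    congr 1; ext z
    have := Phi_neg (l * z)
    simp only [pow_zero, one_mul, phi_neg, mul_neg]
    rw [← mul_add, this, mul_one]
  rw [integral_add (M_int l 0) i] at h2
  unfold MM; linarith

lemma GG_zero (l : ℝ) : l * GG l 0 = bconst * del l / 2 := by
  have e : GG l 0 = (2 * Real.pi)⁻¹ * Real.sqrt (Real.pi / ((1 + l ^ 2) / 2)) := by
    unfold GG
    rw [← integral_gaussian, ← integral_const_mul]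
    congr 1; ext z; rw [phi_mul]; simp
  have h1 : Real.sqrt (Real.pi / ((1 + l ^ 2) / 2)) = Real.pi * Real.sqrt (2 / Real.pi) / Real.sqrt (1 + l ^ 2) := by
    have hp : (0:ℝ) < Real.pi := Real.pi_pos
    rw [show Real.pi / ((1 + l ^ 2) / 2) = (Real.pi ^ 2 * (2 / Real.pi)) / (1 + l ^ 2) by field_simp,
      Real.sqrt_div (by positivity), Real.sqrt_mul (by positivity), Real.sqrt_sq hp.le]
  rw [e, h1]; unfold bconst del
  have hp := Real.pi_ne_zero
  field_simp

theorem stmt_13 (a β l : ℝ) :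
    ∫ z : ℝ, z * f a β l z
      = (-a - 3 * β + bconst * del l
          + bconst * del l * a ^ 2 * (3 + 2 * l ^ 2) / (2 * (1 + l ^ 2))
          + bconst * del l * a * β * (15 + 20 * l ^ 2 + 8 * l ^ 4) / (1 + l ^ 2) ^ 2
          + 3 * bconst * del l * β ^ 2 * (35 + 70 * l ^ 2 + 56 * l ^ 4 + 16 * l ^ 6)
              / (2 * (1 + l ^ 2) ^ 3)) / C a β l := by
  have e : (fun z : ℝ => z * f a β l z) = fun z =>
      (2 * (z ^ 1 * phi z * Phi (l * z)) + (-2 * a) * (z ^ 2 * phi z * Phi (l * z))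
      + (-2 * β) * (z ^ 4 * phi z * Phi (l * z)) + a ^ 2 * (z ^ 3 * phi z * Phi (l * z))
      + (2 * a * β) * (z ^ 5 * phi z * Phi (l * z))
      + β ^ 2 * (z ^ 7 * phi z * Phi (l * z))) / C a β l := by
    ext z; unfold f; ring
  have j := fun (c : ℝ) (n : ℕ) => (M_int l n).const_mul c
  have s1 := (j 2 1).fun_add (j (-2 * a) 2)
  have s2 := s1.fun_add (j (-2 * β) 4)
  have s3 := s2.fun_add (j (a ^ 2) 3)
  have s4 := s3.fun_add (j (2 * a * β) 5)
  rw [e, integral_div, integral_add s4 (j _ 7), integral_add s3 (j _ 5), integral_add s2 (j _ 3),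
    integral_add s1 (j _ 4), integral_add (j _ 1) (j _ 2)]
  simp only [integral_const_mul]
  congr 1
  change 2 * MM l 1 + (-2 * a) * MM l 2 + (-2 * β) * MM l 4 + a ^ 2 * MM l 3
    + (2 * a * β) * MM l 5 + β ^ 2 * MM l 7 = _
  have hc : (1 + l ^ 2) ≠ 0 := by positivity
  have m2 := MM_rec l 0
  have m4 := MM_rec l 2
  have m3 := MM_rec l 1
  have m5 := MM_rec l 3
  have m7 := MM_rec l 5
  have g2 : GG l 2 = GG l 0 / (1 + l ^ 2) := by
    rw [eq_div_iff hc]; have := GG_rec l 0; norm_num at this; linarith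
  have g4 : GG l 4 = 3 * GG l 2 / (1 + l ^ 2) := by
    rw [eq_div_iff hc]; have := GG_rec l 2; norm_num at this; linarith
  have g6 : GG l 6 = 5 * GG l 4 / (1 + l ^ 2) := by
    rw [eq_div_iff hc]; have := GG_rec l 4; norm_num at this; linarith
  norm_num [GG_odd l 1 (by decide), GG_odd l 3 (by decide), MM_zero, MM_one] at m2 m4 m3 m5 m7
  rw [m7, m5, m4, m3, m2, MM_one, g6, g4, g2]
  have hb : bconst * del l = 2 * (l * GG l 0) := by rw [GG_zero]; ring
  simp only [mul_assoc 3 bconst, hb]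
  field_simp
  ring
end
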